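/- arXiv:1910.10654 — 2 statements merged into one kernel-verified Lean document; each statement's English description precedes it below -/
import Mathlib

section
/- Let G : ℝ → ℝ be differentiable on (0,∞), strictly increasing on (0,∞), and such that the map r ↦ G'(r)/r is strictly decreasing on (0,∞). Then for all real r > 0 and r₀ > 0, G(r) ≤ G'(r₀)·r²/(2·r₀) + (G(r₀) − (r₀/2)·G'(r₀)), with equality when r = r₀. -/
/-- Cauchy's mean value theorem against `t ↦ t ^ 2` on the positive half-line. -/
theorem exists_sub_eq_deriv_div_mul_sq_sub_sq {G : ℝ → ℝ}
    (hdiff : DifferentiableOn ℝ G (Set.Ioi 0)) {a b : ℝ} (ha : 0 < a) (hab : a < b) :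
    ∃ c ∈ Set.Ioo a b, G b - G a = deriv G c / c * ((b ^ 2 - a ^ 2) / 2) := by
  obtain ⟨c, hc, h⟩ := exists_ratio_hasDerivAt_eq_ratio_slope G (deriv G) hab
    (hdiff.continuousOn.mono fun x hx => ha.trans_le hx.1)
    (fun x hx => (hdiff.differentiableAt (Ioi_mem_nhds (ha.trans hx.1))).hasDerivAt)
    (fun x => x ^ 2) (fun x => 2 * x) (by fun_prop)
    (fun x _ => by simpa using hasDerivAt_pow 2 x)
  refine ⟨c, hc, ?_⟩
  have hc0 : c ≠ 0 := (ha.trans hc.1).ne'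
  field_simp
  linarith

/-- Quadratic majorization inequality for super-Gaussian contrast functions:
if `G` is differentiable and strictly increasing on `(0,∞)` and `r ↦ G'(r)/r`
is strictly decreasing on `(0,∞)`, then
`G r ≤ G'(r₀)·r²/(2·r₀) + (G r₀ − (r₀/2)·G'(r₀))`, with equality when `r = r₀`. -/
theorem stmt_0 (G : ℝ → ℝ)
    (hdiff : DifferentiableOn ℝ G (Set.Ioi 0))
    (hmono : StrictMonoOn G (Set.Ioi 0))
    (hanti : StrictAntiOn (fun t => deriv G t / t) (Set.Ioi 0)) :
    ∀ r r₀ : ℝ, 0 < r → 0 < r₀ →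
      G r ≤ deriv G r₀ * r ^ 2 / (2 * r₀) + (G r₀ - r₀ / 2 * deriv G r₀) ∧
      (r = r₀ →
        G r = deriv G r₀ * r ^ 2 / (2 * r₀) + (G r₀ - r₀ / 2 * deriv G r₀)) := by
  intro r r₀ hr hr₀
  have key : deriv G r₀ * r ^ 2 / (2 * r₀) + (G r₀ - r₀ / 2 * deriv G r₀) =
      G r₀ + deriv G r₀ / r₀ * ((r ^ 2 - r₀ ^ 2) / 2) := by
    field_simp
    ring
  rw [key]
  refine ⟨?_, fun h => by simp [h]⟩
  rcases lt_trichotomy r r₀ with h | rfl | h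
  · obtain ⟨c, hc, hG⟩ := exists_sub_eq_deriv_div_mul_sq_sub_sq hdiff hr h
    have hlt : deriv G r₀ / r₀ < deriv G c / c := hanti (hr.trans hc.1) hr₀ hc.2
    have hsq : 0 ≤ (r₀ ^ 2 - r ^ 2) / 2 := by nlinarith
    linarith [mul_le_mul_of_nonneg_right hlt.le hsq]
  · simp
  · obtain ⟨c, hc, hG⟩ := exists_sub_eq_deriv_div_mul_sq_sub_sq hdiff hr₀ h
    have hlt : deriv G c / c < deriv G r₀ / r₀ := hanti hr₀ (hr₀.trans hc.1) hc.1
    have hsq : 0 ≤ (r ^ 2 - r₀ ^ 2) / 2 := by nlinarith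
    linarith [mul_le_mul_of_nonneg_right hlt.le hsq]
end

section
/- Let M ≥ 2 and let V, C, B be matrices over ℂ with V Hermitian positive definite (M×M), C = QᴴQ for an invertible M×M matrix Q, and B = UᴴU for an invertible (M−1)×(M−1) matrix U. Let Ṽ = Q⁻ᴴ V Q⁻¹, and let r₁,…,r_M ∈ ℂ^M be an orthonormal eigenbasis of Ṽ with corresponding (positive real) eigenvalues λ₁,…,λ_M. Fix k ∈ {1,…,M}, let R̄_k be the M×(M−1) matrix whose columns are the r_ℓ for ℓ ≠ k, and set w = λ_k^{−1/2}·Q⁻¹·r_k and J = Q⁻¹·R̄_k·U. Then: (i) wᴴ V w = 1, (ii) wᴴ C J = 0 (the zero row vector), (iii) Jᴴ V w = 0 (the zero column vector), and (iv) Jᴴ C J = B. -/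
open Matrix ComplexOrder

/-- Exact solutions of the HEAD system arising in FIVE.  The ambient dimension
is `M + 2` (encoding `M ≥ 2` of the informal statement) and the background
dimension is `M + 1`.  With `C = QᴴQ`, `B = UᴴU`, `r₁,…` an orthonormal
eigenbasis of `Ṽ = Q⁻ᴴ V Q⁻¹` with positive eigenvalues `λᵢ`, and
`w = λ_k^{-1/2} Q⁻¹ r_k`, `J = Q⁻¹ R̄_k U` (where `R̄_k` drops column `k`),
one has `wᴴVw = 1`, `wᴴCJ = 0`, `JᴴVw = 0`, and `JᴴCJ = B`. -/
theorem stmt_3 (M : ℕ)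
    (V : Matrix (Fin (M + 2)) (Fin (M + 2)) ℂ) (hV : V.PosDef)
    (Q : Matrix (Fin (M + 2)) (Fin (M + 2)) ℂ) (hQ : IsUnit Q.det)
    (U : Matrix (Fin (M + 1)) (Fin (M + 1)) ℂ) (hU : IsUnit U.det)
    (C : Matrix (Fin (M + 2)) (Fin (M + 2)) ℂ) (hC : C = Qᴴ * Q)
    (B : Matrix (Fin (M + 1)) (Fin (M + 1)) ℂ) (hB : B = Uᴴ * U)
    (r : Fin (M + 2) → (Fin (M + 2) → ℂ))
    (horth : ∀ i j, star (r i) ⬝ᵥ r j = if i = j then (1 : ℂ) else 0)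
    (lam : Fin (M + 2) → ℝ) (hlam : ∀ i, 0 < lam i)
    (heig : ∀ i, ((Q⁻¹)ᴴ * V * Q⁻¹) *ᵥ r i = (lam i : ℂ) • r i)
    (k : Fin (M + 2))
    (Rbar : Matrix (Fin (M + 2)) (Fin (M + 1)) ℂ)
    (hRbar : Rbar = Matrix.of fun i j => r (k.succAbove j) i)
    (w : Fin (M + 2) → ℂ)
    (hw : w = ((((Real.sqrt (lam k))⁻¹ : ℝ)) : ℂ) • (Q⁻¹ *ᵥ r k))
    (J : Matrix (Fin (M + 2)) (Fin (M + 1)) ℂ)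
    (hJ : J = Q⁻¹ * Rbar * U) :
    star w ⬝ᵥ V *ᵥ w = 1 ∧
    (star w) ᵥ* (C * J) = 0 ∧
    Jᴴ *ᵥ (V *ᵥ w) = 0 ∧
    Jᴴ * C * J = B := by
  have hQJ : Q * J = Rbar * U := by
    rw [hJ, Matrix.mul_assoc, Matrix.mul_nonsing_inv_cancel_left _ _ hQ]
  have hQw : Q *ᵥ w = (((Real.sqrt (lam k))⁻¹ : ℝ) : ℂ) • r k := by
    rw [hw, mulVec_smul, mulVec_mulVec, Matrix.mul_nonsing_inv _ hQ, one_mulVec]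
  have hQQ : Qᴴ * (Q⁻¹)ᴴ = 1 := by
    rw [← conjTranspose_mul, Matrix.nonsing_inv_mul _ hQ, conjTranspose_one]
  have hVr : V *ᵥ (Q⁻¹ *ᵥ r k) = (lam k : ℂ) • (Qᴴ *ᵥ r k) := by
    rw [← mulVec_smul, ← heig k, mulVec_mulVec, mulVec_mulVec, ← Matrix.mul_assoc,
      ← Matrix.mul_assoc, hQQ, Matrix.one_mul]
  have hVw : V *ᵥ w =
      ((((Real.sqrt (lam k))⁻¹ : ℝ) : ℂ) * (lam k : ℂ)) • (Qᴴ *ᵥ r k) := by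
    rw [hw, mulVec_smul, hVr, smul_smul]
  have hRR : Rbarᴴ * Rbar = 1 := by
    ext i j
    have h := horth (k.succAbove i) (k.succAbove j)
    simp only [Fin.succAbove_right_inj] at h
    rw [one_apply, ← h, hRbar]
    rfl
  have hRr : Rbarᴴ *ᵥ r k = 0 := by
    ext i
    have h := horth (k.succAbove i) k
    rw [if_neg (Fin.succAbove_ne k i)] at h
    rw [Pi.zero_apply, ← h, hRbar]
    rfl
  have hrR : star (r k) ᵥ* Rbar = 0 := by
    rw [← conjTranspose_conjTranspose Rbar, ← star_mulVec, hRr, star_zero]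
  refine ⟨?_, ?_, ?_, ?_⟩
  · have hs : ((Real.sqrt (lam k))⁻¹ * lam k) * (Real.sqrt (lam k))⁻¹ = 1 := by
      have hpos := Real.sqrt_pos.mpr (hlam k)
      field_simp
      exact (Real.sq_sqrt (hlam k).le).symm
    rw [hVw, dotProduct_smul, dotProduct_mulVec, ← star_mulVec, hQw, star_smul, smul_dotProduct,
      horth, if_pos rfl, smul_eq_mul, smul_eq_mul, mul_one, RCLike.star_def, Complex.conj_ofReal]
    exact_mod_cast hs
  · rw [hC, Matrix.mul_assoc, hQJ, ← vecMul_vecMul, ← star_mulVec, hQw, star_smul, smul_vecMul,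
      ← vecMul_vecMul, hrR, zero_vecMul, smul_zero]
  · rw [hVw, mulVec_smul, mulVec_mulVec, ← conjTranspose_mul, hQJ, conjTranspose_mul,
      ← mulVec_mulVec, hRr, mulVec_zero, smul_zero]
  · rw [hC, hB, ← Matrix.mul_assoc, ← conjTranspose_mul, Matrix.mul_assoc, hQJ, conjTranspose_mul,
      Matrix.mul_assoc, ← Matrix.mul_assoc Rbarᴴ, hRR, Matrix.one_mul]
end
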